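/- arXiv:2604.05956 — 3 statements merged into one kernel-verified Lean document; each statement's English description precedes it below -/
import Mathlib

section
/- Let m ≥ 1 and n ≥ 2m + 1 (so that 2m − 1 ≤ n − 2). Then the number of strictly increasing m-tuples J = (a₁ < ⋯ < a_m) with entries in {1,…,n−1} such that x_J² = (x₁x₃x₅⋯x_{2m−1})² in the quotient ring F₂[x₁,…,x_{n−1}]/I(n) equals the Catalan number C_m. -/
open MvPolynomial

/-- The Lee–Szczarba ideal `I(n)` of `F₂[x₁,…,x_{n−1}]`, generated by
`xᵢ² + xᵢ·xᵢ₊₁` for `1 ≤ i ≤ n−2` together with `x_{n−1}²`.  Here `m = n − 1` is the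
number of variables, and the variable `x_{i+1}` (1-based) is `X i` for `i : Fin m`
(0-based). -/
noncomputable def lsIdeal (m : ℕ) : Ideal (MvPolynomial (Fin m) (ZMod 2)) :=
  Ideal.span
    ({q | ∃ i j : Fin m, (j : ℕ) = (i : ℕ) + 1 ∧ q = X i ^ 2 + X i * X j} ∪
     {q | ∃ i : Fin m, (i : ℕ) = m - 1 ∧ q = X i ^ 2})

section Ballot

/-- Strictly increasing sequences `a₀ < ⋯ < a_{m-1} < b` with `aⱼ ≤ 2j`. -/
def ballotSeq (m b : ℕ) : Set (Fin m → ℕ) :=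
  {a | StrictMono a ∧ (∀ j, a j ≤ 2 * (j : ℕ)) ∧ ∀ j, a j < b}

theorem ballotSeq_finite (m b : ℕ) : (ballotSeq m b).Finite :=
  (Set.Finite.pi' fun _ : Fin m => Set.finite_Iio b).subset fun _ ha => ha.2.2

theorem snoc_mem_ballotSeq {m b : ℕ} (hb : b ≤ 2 * m) {a : Fin m → ℕ} (ha : a ∈ ballotSeq m b) :
    (Fin.snoc a b : Fin (m + 1) → ℕ) ∈ ballotSeq (m + 1) (b + 1) := by
  obtain ⟨h1, h2, h3⟩ := ha
  refine ⟨?_, ?_, ?_⟩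
  · intro i j
    induction i using Fin.lastCases with
    | last => intro h; exact absurd h (not_lt.2 (Fin.le_last j))
    | cast i =>
      induction j using Fin.lastCases with
      | last => intro _; simpa using h3 i
      | cast j => intro h; simpa using h1 (Fin.castSucc_lt_castSucc_iff.1 h)
  · intro j
    induction j using Fin.lastCases with
    | last => simpa using hb
    | cast j => simpa using h2 j
  · intro j
    induction j using Fin.lastCases with
    | last => simp
    | cast j => simpa using (h3 j).le

theorem ballotSeq_succ_succ {m b : ℕ} (hb : b ≤ 2 * m) :
    ballotSeq (m + 1) (b + 1) =
      ballotSeq (m + 1) b ∪ (fun a => (Fin.snoc a b : Fin (m + 1) → ℕ)) '' ballotSeq m b := by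
  ext a
  constructor
  · rintro ⟨h1, h2, h3⟩
    have hmono : ∀ j, a j ≤ a (Fin.last m) := fun j => h1.monotone (Fin.le_last j)
    by_cases h : a (Fin.last m) < b
    · exact Or.inl ⟨h1, h2, fun j => (hmono j).trans_lt h⟩
    · have hl : a (Fin.last m) = b := by have := h3 (Fin.last m); omega
      refine Or.inr ⟨Fin.init a, ⟨h1.comp Fin.strictMono_castSucc, fun j => h2 j.castSucc,
        fun j => ?_⟩, ?_⟩
      · rw [← hl]; exact h1 (Fin.castSucc_lt_last j)
      · simp only [← hl, Fin.snoc_init_self]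
  · rintro (⟨h1, h2, h3⟩ | ⟨a, ha, rfl⟩)
    · exact ⟨h1, h2, fun j => (h3 j).trans (Nat.lt_succ_self b)⟩
    · exact snoc_mem_ballotSeq hb ha

theorem ncard_ballotSeq_succ_succ {m b : ℕ} (hb : b ≤ 2 * m) :
    (ballotSeq (m + 1) (b + 1)).ncard = (ballotSeq (m + 1) b).ncard + (ballotSeq m b).ncard := by
  rw [ballotSeq_succ_succ hb, Set.ncard_union_eq _ (ballotSeq_finite _ _)
    ((ballotSeq_finite _ _).image _), Set.ncard_image_of_injective]
  · intro a a' h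
    exact (Fin.snoc_inj.1 h).1
  · rw [Set.disjoint_left]
    rintro _ ⟨_, _, h3⟩ ⟨a, _, rfl⟩
    simpa using h3 (Fin.last m)

theorem ballotSeq_two_mul_add_two (m : ℕ) :
    ballotSeq (m + 1) (2 * m + 2) = ballotSeq (m + 1) (2 * m + 1) := by
  ext a
  refine and_congr_right fun _ => and_congr_right fun h2 => ⟨fun _ j => ?_, fun h3 j => ?_⟩
  · have := h2 j; have := j.isLt; omega
  · exact (h3 j).trans (Nat.lt_succ_self _)

/-- The ballot numbers. -/
theorem ncard_ballotSeq_add_choose (m b : ℕ) (hb : b ≤ 2 * m) :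
    (ballotSeq m b).ncard + b.choose (m + 1) = b.choose m := by
  induction b generalizing m with
  | zero =>
    cases m with
    | zero =>
      have : ballotSeq 0 0 = Set.univ := by
        ext a; simp [ballotSeq, Subsingleton.strictMono]
      simp [this, Set.ncard_univ]
    | succ m =>
      have : ballotSeq (m + 1) 0 = ∅ := by
        ext a; simp [ballotSeq]
      simp [this]
  | succ b ih =>
    cases m with
    | zero => omega
    | succ m =>
      have h1 := Nat.choose_succ_succ' b m
      have h2 := Nat.choose_succ_succ' b (m + 1)
      by_cases h : b ≤ 2 * m
      · have := ih m h
        have := ih (m + 1) (by omega)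
        rw [ncard_ballotSeq_succ_succ h]
        omega
      · obtain rfl : b = 2 * m + 1 := by omega
        have := ih (m + 1) (by omega)
        have hs : (2 * m + 1).choose (m + 1) = (2 * m + 1).choose m :=
          Nat.choose_symm_half m
        rw [ballotSeq_two_mul_add_two]
        omega

theorem ncard_ballotSeq_two_mul (m : ℕ) : (ballotSeq m (2 * m)).ncard = catalan m := by
  have h1 := ncard_ballotSeq_add_choose m (2 * m) le_rfl
  have h2 := succ_mul_catalan_eq_centralBinom m
  have h3 := Nat.choose_succ_right_eq (2 * m) m
  rw [Nat.centralBinom_eq_two_mul_choose] at h2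
  rw [show 2 * m - m = m by omega] at h3
  refine Nat.eq_of_mul_eq_mul_left (Nat.succ_pos m) ?_
  rw [Nat.succ_eq_add_one, h2]
  nlinarith

end Ballot

section Reduction

variable {R : Type*} [CommRing R] {N : ℕ} {y : ℕ → R}

theorem prod_range_mul_eq_prod_range_succ (hy : ∀ i, i + 1 < N → y i ^ 2 = y i * y (i + 1))
    {a k : ℕ} (hak : a ≤ k) (hk : k < N) :
    (∏ i ∈ Finset.range k, y i) * y a = ∏ i ∈ Finset.range (k + 1), y i := by
  obtain ⟨d, rfl⟩ := Nat.exists_eq_add_of_le hak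
  induction d generalizing a with
  | zero => rw [Finset.prod_range_succ, add_zero]
  | succ d ih =>
    have hstep := ih (a := a + 1) (by omega) (by omega)
    rw [show a + 1 + d = a + (d + 1) by omega] at hstep
    rw [← hstep, ← Finset.mul_prod_erase (Finset.range (a + (d + 1))) y
      (Finset.mem_range.2 (show a < a + (d + 1) by omega))]
    linear_combination (∏ x ∈ (Finset.range (a + (d + 1))).erase a, y x) * hy a (by omega)

theorem prod_sq_eq_prod_range (hy : ∀ i, i + 1 < N → y i ^ 2 = y i * y (i + 1))
    {m : ℕ} (hm : 2 * m ≤ N) (a : Fin m → ℕ) (ha : ∀ j, a j ≤ 2 * (j : ℕ)) :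
    ∏ j, y (a j) ^ 2 = ∏ i ∈ Finset.range (2 * m), y i := by
  induction m with
  | zero => simp
  | succ m ih =>
    have hl : a (Fin.last m) ≤ 2 * m := by simpa using ha (Fin.last m)
    rw [Fin.prod_univ_castSucc, ih (by omega) (fun j => a j.castSucc) fun j => ha j.castSucc,
      sq, ← mul_assoc, prod_range_mul_eq_prod_range_succ hy hl (by omega),
      prod_range_mul_eq_prod_range_succ hy (show a (Fin.last m) ≤ 2 * m + 1 by omega) (by omega)]
    rfl

end Reduction

section Parking

variable {N : ℕ}

/-- The number of variables of index less than `k`, with multiplicity, in the monomial `s`. -/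
def lowDegree (k : ℕ) (s : Fin N →₀ ℕ) : ℕ :=
  ∑ i : Fin N, if (i : ℕ) < k then s i else 0

theorem lowDegree_add (k : ℕ) (s t : Fin N →₀ ℕ) :
    lowDegree k (s + t) = lowDegree k s + lowDegree k t := by
  simp only [lowDegree, ← Finset.sum_add_distrib]
  refine Finset.sum_congr rfl fun i _ => ?_
  split_ifs <;> simp

theorem lowDegree_single (k : ℕ) (i : Fin N) (c : ℕ) :
    lowDegree k (Finsupp.single i c) = if (i : ℕ) < k then c else 0 := by
  rw [lowDegree, Finset.sum_eq_single i]
  · simp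
  · intro j _ hj
    simp [Finsupp.single_eq_of_ne hj]
  · simp

theorem lowDegree_mono {k l : ℕ} (h : k ≤ l) (s : Fin N →₀ ℕ) :
    lowDegree k s ≤ lowDegree l s := by
  refine Finset.sum_le_sum fun i _ => ?_
  split_ifs <;> omega

theorem lowDegree_sum {ι : Type*} (k : ℕ) (t : Finset ι) (f : ι → Fin N →₀ ℕ) :
    lowDegree k (∑ j ∈ t, f j) = ∑ j ∈ t, lowDegree k (f j) := by
  classical
  induction t using Finset.induction_on with
  | empty => simp [lowDegree]
  | insert j t hj ih => rw [Finset.sum_insert hj, Finset.sum_insert hj, lowDegree_add, ih]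

/-- The monomials of degree `d` that reduce to the product of the first `d` variables. -/
def IsParking (d : ℕ) (s : Fin N →₀ ℕ) : Prop :=
  lowDegree N s = d ∧ ∀ k ≤ d, k ≤ lowDegree k s

theorem isParking_add_generator (d : ℕ) (s : Fin N →₀ ℕ) {i j : Fin N}
    (hij : (j : ℕ) = (i : ℕ) + 1) :
    IsParking d (s + Finsupp.single i 2) ↔
      IsParking d (s + (Finsupp.single i 1 + Finsupp.single j 1)) := by
  have hi := i.isLt
  have hj := j.isLt
  simp only [IsParking, lowDegree_add, lowDegree_single, hi, hj, if_true]
  refine and_congr_right fun _ => ⟨fun h k hk => ?_, fun h k hk => ?_⟩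
  · have h1 := h k hk
    by_cases hki : k = i + 1
    · have h2 := h i (by omega)
      have h3 := lowDegree_mono (show (i : ℕ) ≤ k by omega) s
      split_ifs at * <;> omega
    · split_ifs at * <;> omega
  · have h1 := h k hk
    split_ifs at * <;> omega

theorem not_isParking_add_last {d : ℕ} (hd : d ≤ N) (s : Fin N →₀ ℕ) {i : Fin N}
    (hi : (i : ℕ) = N - 1) : ¬ IsParking d (s + Finsupp.single i 2) := by
  rintro ⟨h1, h2⟩
  have hN := i.isLt
  have h3 := h2 (min d (N - 1)) (min_le_left _ _)
  have h4 := lowDegree_mono (show min d (N - 1) ≤ N by omega) s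
  simp only [lowDegree_add, lowDegree_single] at h1 h3
  split_ifs at * <;> omega

open Classical in
/-- The linear functional summing the coefficients of all parking monomials. -/
noncomputable def parkingFunctional (N d : ℕ) : MvPolynomial (Fin N) (ZMod 2) →ₗ[ZMod 2] ZMod 2 :=
  (basisMonomials (Fin N) (ZMod 2)).constr (ZMod 2) fun s => if IsParking d s then 1 else 0

open Classical in
theorem parkingFunctional_monomial (d : ℕ) (s : Fin N →₀ ℕ) :
    parkingFunctional N d (monomial s 1) = if IsParking d s then 1 else 0 := by
  have := (basisMonomials (Fin N) (ZMod 2)).constr_basis (ZMod 2)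
    (fun s => if IsParking d s then (1 : ZMod 2) else 0) s
  rwa [coe_basisMonomials] at this

theorem parkingFunctional_mul_eq_zero {d : ℕ} {g : MvPolynomial (Fin N) (ZMod 2)}
    (hg : ∀ s, parkingFunctional N d (monomial s 1 * g) = 0) (p : MvPolynomial (Fin N) (ZMod 2)) :
    parkingFunctional N d (p * g) = 0 := by
  induction p using MvPolynomial.induction_on' with
  | monomial s c =>
    have hc : monomial s c = c • monomial s (1 : ZMod 2) := by
      rw [smul_monomial, smul_eq_mul, mul_one]
    rw [hc, smul_mul_assoc, map_smul, hg, smul_zero]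
  | add p q hp hq => rw [add_mul, map_add, hp, hq, add_zero]

theorem parkingFunctional_eq_zero_of_mem {d : ℕ} (hd : d ≤ N)
    {q : MvPolynomial (Fin N) (ZMod 2)} (hq : q ∈ lsIdeal N) : parkingFunctional N d q = 0 := by
  suffices h : ∀ p, parkingFunctional N d (p * q) = 0 by simpa using h 1
  refine Submodule.span_induction ?_ ?_ ?_ ?_ hq
  · rintro g (⟨i, j, hij, rfl⟩ | ⟨i, hi, rfl⟩)
    · refine parkingFunctional_mul_eq_zero fun s => ?_
      rw [mul_add, X_pow_eq_monomial, X, X, monomial_mul, monomial_mul, monomial_mul, map_add]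
      rw [mul_one, mul_one, parkingFunctional_monomial, parkingFunctional_monomial,
        propext (isParking_add_generator d s hij)]
      exact CharTwo.add_self_eq_zero (R := ZMod 2) _
    · refine parkingFunctional_mul_eq_zero fun s => ?_
      rw [X_pow_eq_monomial, monomial_mul, mul_one, parkingFunctional_monomial,
        if_neg (not_isParking_add_last hd s hi)]
  · simp
  · intro x y _ _ hx hy p
    rw [mul_add, map_add, hx, hy, add_zero]
  · intro a x _ hx p
    rw [smul_eq_mul, ← mul_assoc, hx]

theorem prod_X_sq_eq_monomial {m : ℕ} (a : Fin m → Fin N) :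
    ((∏ j, X (a j)) ^ 2 : MvPolynomial (Fin N) (ZMod 2)) =
      monomial (∑ j, Finsupp.single (a j) 2) 1 := by
  rw [← Finset.prod_pow, monomial_sum_one]
  simp only [X_pow_eq_monomial]

theorem lowDegree_sum_single {m : ℕ} (a : Fin m → Fin N) (k : ℕ) :
    lowDegree k (∑ j, Finsupp.single (a j) 2) = 2 * {j | (a j : ℕ) < k}.ncard := by
  classical
  rw [lowDegree_sum, Set.ncard_eq_toFinset_card']
  simp only [lowDegree_single, ← Finset.sum_filter, Finset.sum_const, smul_eq_mul]
  rw [mul_comm]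
  congr 2
  ext; simp

theorem isParking_sum_single_iff {m : ℕ} {a : Fin m → Fin N} (ha : StrictMono a) :
    IsParking (2 * m) (∑ j, Finsupp.single (a j) 2) ↔ ∀ j, (a j : ℕ) ≤ 2 * (j : ℕ) := by
  simp only [IsParking, lowDegree_sum_single]
  constructor
  · rintro ⟨-, h⟩ j
    by_contra! hj
    have h1 := h (2 * j + 1) (by have := j.isLt; omega)
    have h2 : {l | (a l : ℕ) < 2 * j + 1} ⊆ Set.Iio j := by
      intro l hl
      by_contra hlj
      have := ha.monotone (not_lt.1 hlj)
      simp only [Set.mem_ofPred_eq, Fin.le_def] at hl this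
      omega
    have h3 := Set.ncard_le_ncard h2
    rw [Set.ncard_eq_toFinset_card' (Set.Iio j), Set.toFinset_Iio, Fin.card_Iio] at h3
    omega
  · intro h
    refine ⟨by simp [Set.ncard_univ], fun k hk => ?_⟩
    have h2 : (Fin.castLE (show (k + 1) / 2 ≤ m by omega)) '' Set.univ ⊆ {l | (a l : ℕ) < k} := by
      rintro _ ⟨l, -, rfl⟩
      have h1 := h (Fin.castLE (show (k + 1) / 2 ≤ m by omega) l)
      have := l.isLt
      simp only [Set.mem_ofPred_eq, Fin.val_castLE] at h1 ⊢
      omega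
    have h3 := Set.ncard_le_ncard h2
    rw [Set.ncard_image_of_injective _ (Fin.castLE_injective _), Set.ncard_univ, Nat.card_fin] at h3
    omega

end Parking

theorem mk_lsIdeal_sq {N : ℕ} {i j : Fin N} (hij : (j : ℕ) = (i : ℕ) + 1) :
    Ideal.Quotient.mk (lsIdeal N) (X i) ^ 2 =
      Ideal.Quotient.mk (lsIdeal N) (X i) * Ideal.Quotient.mk (lsIdeal N) (X j) := by
  rw [← map_pow, ← map_mul, Ideal.Quotient.eq, CharTwo.sub_eq_add]
  exact Ideal.subset_span (Or.inl ⟨i, j, hij, rfl⟩)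

theorem mk_prod_X_sq_eq {N m : ℕ} (hm : 2 * m ≤ N) {a b : Fin m → Fin N}
    (ha : ∀ j, (a j : ℕ) ≤ 2 * (j : ℕ)) (hb : ∀ j, (b j : ℕ) ≤ 2 * (j : ℕ)) :
    Ideal.Quotient.mk (lsIdeal N) ((∏ j, X (a j)) ^ 2) =
      Ideal.Quotient.mk (lsIdeal N) ((∏ j, X (b j)) ^ 2) := by
  let y : ℕ → MvPolynomial (Fin N) (ZMod 2) ⧸ lsIdeal N := fun i =>
    if h : i < N then Ideal.Quotient.mk (lsIdeal N) (X ⟨i, h⟩) else 0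
  have hy : ∀ i, i + 1 < N → y i ^ 2 = y i * y (i + 1) := fun i hi => by
    simp only [y, hi, (Nat.lt_succ_self i).trans hi, dif_pos]
    exact mk_lsIdeal_sq rfl
  have hred : ∀ c : Fin m → Fin N, (∀ j, (c j : ℕ) ≤ 2 * (j : ℕ)) →
      Ideal.Quotient.mk (lsIdeal N) ((∏ j, X (c j)) ^ 2) = ∏ i ∈ Finset.range (2 * m), y i := by
    intro c hc
    rw [← prod_sq_eq_prod_range hy hm (fun j => (c j : ℕ)) hc, ← Finset.prod_pow, map_prod]
    refine Finset.prod_congr rfl fun j _ => ?_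
    simp [y]
  rw [hred a ha, hred b hb]

theorem mk_prod_X_sq_eq_iff {N m : ℕ} (hm : 2 * m ≤ N) {a b : Fin m → Fin N}
    (ha : StrictMono a) (hb : StrictMono b) (hb' : ∀ j, (b j : ℕ) ≤ 2 * (j : ℕ)) :
    Ideal.Quotient.mk (lsIdeal N) ((∏ j, X (a j)) ^ 2) =
      Ideal.Quotient.mk (lsIdeal N) ((∏ j, X (b j)) ^ 2) ↔ ∀ j, (a j : ℕ) ≤ 2 * (j : ℕ) := by
  refine ⟨fun h => ?_, fun h => mk_prod_X_sq_eq hm h hb'⟩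
  have h0 := parkingFunctional_eq_zero_of_mem hm (Ideal.Quotient.eq.1 h)
  rw [map_sub, prod_X_sq_eq_monomial, prod_X_sq_eq_monomial, parkingFunctional_monomial,
    parkingFunctional_monomial, if_pos ((isParking_sum_single_iff hb).2 hb')] at h0
  rw [← isParking_sum_single_iff ha]
  by_contra hn
  simp [hn] at h0

/-- Let `m ≥ 1` and `n ≥ 2m + 1`.  The number of strictly increasing
`m`-tuples `J` with entries in `{1,…,n−1}` (encoded as strictly monotone maps
`Fin m → Fin (n-1)`, 0-based) such that `x_J² = (x₁x₃⋯x_{2m−1})²` in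
`F₂[x₁,…,x_{n−1}]/I(n)` equals the Catalan number `C_m`. -/
theorem stmt6 (m n : ℕ) (hm : 1 ≤ m) (hn : 2 * m + 1 ≤ n) :
    Nat.card {a : Fin m → Fin (n - 1) // StrictMono a ∧
      Ideal.Quotient.mk (lsIdeal (n - 1)) ((∏ j : Fin m, X (a j)) ^ 2) =
      Ideal.Quotient.mk (lsIdeal (n - 1))
        ((∏ j : Fin m, X (⟨2 * (j : ℕ), by have := j.isLt; omega⟩ : Fin (n - 1))) ^ 2)} =
    catalan m := by
  have hcard : ∀ b : Fin m → Fin (n - 1), StrictMono b → (∀ j, (b j : ℕ) ≤ 2 * (j : ℕ)) →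
      Nat.card {a : Fin m → Fin (n - 1) // StrictMono a ∧
        Ideal.Quotient.mk (lsIdeal (n - 1)) ((∏ j, X (a j)) ^ 2) =
        Ideal.Quotient.mk (lsIdeal (n - 1)) ((∏ j, X (b j)) ^ 2)} = catalan m := by
    intro b hb hb'
    rw [← ncard_ballotSeq_two_mul, ← Nat.card_coe_set_eq]
    refine Nat.card_congr ⟨fun a => ⟨fun j => a.1 j, a.2.1, ?_⟩,
      fun a => ⟨fun j => ⟨a.1 j, ?_⟩, a.2.1, ?_⟩, fun _ => rfl, fun _ => rfl⟩
    · have h := (mk_prod_X_sq_eq_iff (by omega) a.2.1 hb hb').1 a.2.2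
      exact ⟨h, fun j => (h j).trans_lt (by omega)⟩
    · exact (a.2.2.2 j).trans_le (by omega)
    · refine (mk_prod_X_sq_eq_iff (by omega) ?_ hb hb').2 a.2.2.1
      exact a.2.1
  refine hcard _ (fun i j hij => ?_) fun j => le_rfl
  simp only [Fin.lt_def] at hij ⊢
  omega
end

section
/- Let n ≥ 2 and 1 ≤ k ≤ n. Then the image of σ_k(x₁,…,x_{n−1})² in the quotient ring F₂[x₁,…,x_{n−1}]/I(n) is nonzero if and only if n ≥ 2k + s(k). -/
open MvPolynomial

/-- `s(k)`: the least `s ≥ 1` such that `k = (2^{r₁} − 1) + ⋯ + (2^{r_s} − 1)` for some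
integers `r₁,…,r_s ≥ 0`. -/
noncomputable def sOf (k : ℕ) : ℕ :=
  sInf {s : ℕ | 1 ≤ s ∧ ∃ r : Fin s → ℕ, k = ∑ j : Fin s, (2 ^ r j - 1)}

/-- The natural numbers of the form `2 ^ r - 1`. -/
def IsMersenne (j : ℕ) : Prop := ∃ r : ℕ, j = 2 ^ r - 1

theorem isMersenne_two_mul_add_one {i : ℕ} : IsMersenne (2 * i + 1) ↔ IsMersenne i := by
  constructor
  · rintro ⟨_ | r, hr⟩
    · simp at hr
    · exact ⟨r, by rw [pow_succ] at hr; omega⟩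
  · rintro ⟨r, hr⟩
    refine ⟨r + 1, ?_⟩
    have := Nat.one_le_two_pow (n := r)
    rw [pow_succ]; omega

theorem odd_choose_two_mul_add_one_iff (j : ℕ) :
    Odd ((2 * j + 1).choose j) ↔ IsMersenne j := by
  induction j using Nat.strong_induction_on with
  | _ j ih =>
    have lucas := Choose.choose_modEq_choose_mod_mul_choose_div_nat (p := 2) (n := 2 * j + 1) (k := j)
    rw [show (2 * j + 1) % 2 = 1 by omega, show (2 * j + 1) / 2 = j by omega] at lucas
    obtain ⟨i, rfl | rfl⟩ := Nat.even_or_odd' j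
    · rw [Nat.odd_iff, lucas, show 2 * i % 2 = 0 by omega, show 2 * i / 2 = i by omega]
      rcases i with _ | i
      · simpa using ⟨0, rfl⟩
      · have := Nat.two_dvd_centralBinom_succ i
        rw [Nat.centralBinom_eq_two_mul_choose] at this
        refine iff_of_false (by simp; omega) ?_
        rintro ⟨_ | r, hr⟩
        · simp at hr
        · have := Nat.one_le_two_pow (n := r)
          rw [pow_succ] at hr; omega
    · rw [Nat.odd_iff, lucas, show (2 * i + 1) % 2 = 1 by omega,
        show (2 * i + 1) / 2 = i by omega, isMersenne_two_mul_add_one, ← ih i (by omega),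
        Nat.odd_iff]
      simp

/-- Modulo two, the coefficient of `y ^ c` counts the nonnegative lattice paths of length `l` that
start at height `0` and end at height `c`, and the exponent of `u` is the number of up-steps. -/
def ballotPoly {B : Type*} [CommSemiring B] (l : ℕ) (u y : B) : B :=
  ∑ j ∈ Finset.range (l / 2 + 1), ((l + 1).choose j : B) * u ^ (l - j) * y ^ (l - 2 * j)

theorem ballotPoly_zero_left {B : Type*} [CommSemiring B] (u y : B) : ballotPoly 0 u y = 1 := by
  simp [ballotPoly]

theorem map_ballotPoly {B D : Type*} [CommSemiring B] [CommSemiring D] (f : B →+* D) (l : ℕ)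
    (u y : B) : f (ballotPoly l u y) = ballotPoly l (f u) (f y) := by
  simp [ballotPoly]

theorem ballotPoly_two_mul_zero {B : Type*} [CommSemiring B] (p : ℕ) (u : B) :
    ballotPoly (2 * p) u 0 = ((2 * p + 1).choose p : B) * u ^ p := by
  rw [ballotPoly, show 2 * p / 2 = p by omega, Finset.sum_range_succ, Finset.sum_eq_zero]
  · simp [show 2 * p - p = p by omega]
  · intro j hj
    rw [Finset.mem_range] at hj
    rw [zero_pow (by omega), mul_zero]

theorem ballotPoly_two_mul_add_one_zero {B : Type*} [CommSemiring B] (p : ℕ) (u : B) :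
    ballotPoly (2 * p + 1) u 0 = 0 := by
  refine Finset.sum_eq_zero fun j hj => ?_
  rw [Finset.mem_range] at hj
  rw [zero_pow (by omega), mul_zero]

theorem ballotPoly_mul_self {B : Type*} [CommRing B] (h2 : (2 : B) = 0) (l : ℕ) (u y : B) :
    ballotPoly l u y * (1 + u * y ^ 2) = y * ballotPoly (l + 1) u y + ballotPoly l u 0 := by
  obtain ⟨p, rfl | rfl⟩ := Nat.even_or_odd' l
  · have h1 : y * ballotPoly (2 * p + 1) u y = ∑ j ∈ Finset.range (p + 1),
        ((2 * p + 2).choose j : B) * u ^ (2 * p + 1 - j) * y ^ (2 * p + 2 - 2 * j) := by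
      rw [ballotPoly, Finset.mul_sum, show (2 * p + 1) / 2 = p by omega]
      refine Finset.sum_congr rfl fun j hj => ?_
      rw [Finset.mem_range] at hj
      rw [show 2 * p + 2 - 2 * j = (2 * p + 1 - 2 * j) + 1 by omega]
      ring
    have h3 : ballotPoly (2 * p) u y * (u * y ^ 2) = ∑ j ∈ Finset.range (p + 1),
        ((2 * p + 1).choose j : B) * u ^ (2 * p + 1 - j) * y ^ (2 * p + 2 - 2 * j) := by
      rw [ballotPoly, Finset.sum_mul, show 2 * p / 2 = p by omega]
      refine Finset.sum_congr rfl fun j hj => ?_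
      rw [Finset.mem_range] at hj
      rw [show 2 * p + 2 - 2 * j = (2 * p - 2 * j) + 2 by omega,
        show 2 * p + 1 - j = (2 * p - j) + 1 by omega]
      ring
    have h4 : ballotPoly (2 * p) u y = ∑ j ∈ Finset.range p,
        ((2 * p + 1).choose j : B) * u ^ (2 * p - j) * y ^ (2 * p - 2 * j)
          + ((2 * p + 1).choose p : B) * u ^ p := by
      rw [ballotPoly, show 2 * p / 2 = p by omega, Finset.sum_range_succ]
      simp [show 2 * p - p = p by omega]
    rw [mul_add, mul_one, h3, h1, h4, ballotPoly_two_mul_zero, Finset.sum_range_succ' _ p,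
      Finset.sum_range_succ' _ p]
    have h5 : ∀ j, ((2 * p + 2).choose (j + 1) : B)
        = (2 * p + 1).choose j + (2 * p + 1).choose (j + 1) := fun j => by
      rw [Nat.choose_succ_succ']; push_cast; rfl
    simp only [h5, add_mul, Finset.sum_add_distrib, Nat.choose_zero_right,
      show ∀ j, 2 * p + 1 - (j + 1) = 2 * p - j by omega,
      show ∀ j, 2 * p + 2 - 2 * (j + 1) = 2 * p - 2 * j by omega]
    ring
  · have h1 : y * ballotPoly (2 * p + 1 + 1) u y = ∑ j ∈ Finset.range (p + 2),
        ((2 * p + 3).choose j : B) * u ^ (2 * p + 2 - j) * y ^ (2 * p + 3 - 2 * j) := by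
      rw [ballotPoly, Finset.mul_sum, show (2 * p + 1 + 1) / 2 = p + 1 by omega]
      refine Finset.sum_congr rfl fun j hj => ?_
      rw [Finset.mem_range] at hj
      rw [show 2 * p + 3 - 2 * j = (2 * p + 1 + 1 - 2 * j) + 1 by omega]
      ring
    have h3 : ballotPoly (2 * p + 1) u y * (u * y ^ 2) = ∑ j ∈ Finset.range (p + 2),
        ((2 * p + 2).choose j : B) * u ^ (2 * p + 2 - j) * y ^ (2 * p + 3 - 2 * j) := by
      have h6 : ((2 * p + 2).choose (p + 1) : B) = 0 := by
        have := Nat.two_dvd_centralBinom_succ p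
        rw [Nat.centralBinom_eq_two_mul_choose] at this
        obtain ⟨c, hc⟩ := this
        rw [show 2 * p + 2 = 2 * (p + 1) by ring, hc]
        push_cast
        rw [h2, zero_mul]
      rw [Finset.sum_range_succ, h6, zero_mul, zero_mul, add_zero,
        ballotPoly, Finset.sum_mul, show (2 * p + 1) / 2 = p by omega]
      refine Finset.sum_congr rfl fun j hj => ?_
      rw [Finset.mem_range] at hj
      rw [show 2 * p + 3 - 2 * j = (2 * p + 1 - 2 * j) + 2 by omega,
        show 2 * p + 2 - j = (2 * p + 1 - j) + 1 by omega]
      ring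
    have h4 : ballotPoly (2 * p + 1) u y = ∑ j ∈ Finset.range (p + 1),
        ((2 * p + 2).choose j : B) * u ^ (2 * p + 1 - j) * y ^ (2 * p + 1 - 2 * j) := by
      rw [ballotPoly, show (2 * p + 1) / 2 = p by omega]
    rw [mul_add, mul_one, h3, h1, h4, ballotPoly_two_mul_add_one_zero,
      Finset.sum_range_succ' _ (p + 1), Finset.sum_range_succ' _ (p + 1)]
    have h5 : ∀ j, ((2 * p + 3).choose (j + 1) : B)
        = (2 * p + 2).choose j + (2 * p + 2).choose (j + 1) := fun j => by
      rw [Nat.choose_succ_succ']; push_cast; rfl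
    simp only [h5, add_mul, Finset.sum_add_distrib, Nat.choose_zero_right,
      show ∀ j, 2 * p + 2 - (j + 1) = 2 * p + 1 - j by omega,
      show ∀ j, 2 * p + 3 - 2 * (j + 1) = 2 * p + 1 - 2 * j by omega]
    ring

theorem mul_ballotPoly_congr {B : Type*} [CommSemiring B] {y z : B} (h : z ^ 2 = z * y) (l : ℕ)
    (u : B) : z * ballotPoly l u z = z * ballotPoly l u y := by
  have key : ∀ c : ℕ, z * z ^ c = z * y ^ c := by
    intro c
    induction c with
    | zero => simp
    | succ c ih =>
      calc z * z ^ (c + 1) = z * (z * z ^ c) := by ring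
        _ = z ^ 2 * y ^ c := by rw [ih]; ring
        _ = z * y ^ (c + 1) := by rw [h]; ring
  simp only [ballotPoly, Finset.mul_sum]
  refine Finset.sum_congr rfl fun j _ => ?_
  rw [mul_left_comm, key, mul_left_comm]

theorem ballotPoly_mul {B : Type*} [CommRing B] (h2 : (2 : B) = 0) {y z : B} (h : z ^ 2 = z * y)
    (l : ℕ) (u : B) :
    ballotPoly l u z * (1 + u * z ^ 2) = z * ballotPoly (l + 1) u y + ballotPoly l u 0 := by
  rw [ballotPoly_mul_self h2, mul_ballotPoly_congr h]

/-- The generating polynomial of the elementary symmetric polynomials in the squares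
`y 1 ^ 2, …, y m ^ 2`. -/
noncomputable def sqGen {A : Type*} [CommRing A] (y : ℕ → A) (m : ℕ) : Polynomial A :=
  ∏ i ∈ Finset.range m, (1 + Polynomial.X * Polynomial.C (y (i + 1)) ^ 2)

/-- The product of `sqGen y m` with the generating polynomial of the lattice paths of length `l`,
a path ending at height `c` being weighted by `y m ^ c`. -/
noncomputable def pathGen {A : Type*} [CommRing A] (y : ℕ → A) (m l : ℕ) : Polynomial A :=
  ballotPoly l Polynomial.X (Polynomial.C (y m)) * sqGen y m

/-- The defining relations of the Lee–Szczarba ring, with the variables listed in reverse order. -/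
structure IsLSSeq {A : Type*} [CommRing A] (y : ℕ → A) (m : ℕ) : Prop where
  two_eq_zero : (2 : A) = 0
  zero : y 0 = 0
  sq : ∀ i < m, y (i + 1) ^ 2 = y (i + 1) * y i

theorem pathGen_zero_right {A : Type*} [CommRing A] (y : ℕ → A) (m : ℕ) :
    pathGen y m 0 = sqGen y m := by
  rw [pathGen, ballotPoly_zero_left, one_mul]

theorem pathGen_zero_left {A : Type*} [CommRing A] {y : ℕ → A} (h : y 0 = 0) (l : ℕ) :
    pathGen y 0 l = ballotPoly l Polynomial.X 0 := by
  simp [pathGen, sqGen, h]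

theorem pathGen_succ {A : Type*} [CommRing A] {y : ℕ → A} {m : ℕ} (h2 : (2 : A) = 0)
    (h : y (m + 1) ^ 2 = y (m + 1) * y m) (l : ℕ) :
    pathGen y (m + 1) l = Polynomial.C (y (m + 1)) * pathGen y m (l + 1)
      + ballotPoly l Polynomial.X 0 * pathGen y m 0 := by
  have h2' : (2 : Polynomial A) = 0 := by
    rw [← map_ofNat (Polynomial.C : A →+* Polynomial A) 2, h2, map_zero]
  have hC : (Polynomial.C (y (m + 1))) ^ 2 = Polynomial.C (y (m + 1)) * Polynomial.C (y m) := by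
    rw [← map_pow, h, map_mul]
  rw [pathGen_zero_right]
  have := ballotPoly_mul h2' hC l Polynomial.X
  rw [pathGen, pathGen, sqGen, Finset.prod_range_succ, ← sqGen]
  linear_combination sqGen y m * this

theorem pathGen_map {A D : Type*} [CommRing A] [CommRing D] (f : A →+* D) {y : ℕ → A} {z : ℕ → D}
    {m : ℕ} (h : ∀ i ≤ m, z i = f (y i)) (l : ℕ) :
    pathGen z m l = (pathGen y m l).map f := by
  rw [pathGen, pathGen, Polynomial.map_mul, ← Polynomial.coe_mapRingHom, map_ballotPoly, sqGen,
    sqGen, map_prod]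
  congr 1
  · simp [h m le_rfl]
  · refine Finset.prod_congr rfl fun i hi => ?_
    simp [h (i + 1) (Finset.mem_range.1 hi)]

theorem natCast_eq_ite_of_two_eq_zero {A : Type*} [CommRing A] (h2 : (2 : A) = 0) (a : ℕ)
    [Decidable (Odd a)] : (a : A) = if Odd a then 1 else 0 := by
  split_ifs with h
  · obtain ⟨b, rfl⟩ := h
    push_cast
    rw [h2]; ring
  · obtain ⟨b, rfl⟩ := Nat.not_odd_iff_even.1 h
    push_cast
    rw [← two_mul, h2, zero_mul]

open Classical in
theorem ballotPoly_X_zero {A : Type*} [CommRing A] (h2 : (2 : A) = 0) (p : ℕ) :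
    ballotPoly (2 * p) (Polynomial.X : Polynomial A) 0
      = if IsMersenne p then Polynomial.X ^ p else 0 := by
  have h2' : (2 : Polynomial A) = 0 := by
    rw [← map_ofNat (Polynomial.C : A →+* Polynomial A) 2, h2, map_zero]
  rw [ballotPoly_two_mul_zero, natCast_eq_ite_of_two_eq_zero h2', ite_mul, one_mul, zero_mul]
  simp only [odd_choose_two_mul_add_one_iff]

/-- The condition under which the coefficient of `u ^ k` in `pathGen y m l` is nonzero for
independent variables: a run of length `2 * j` is being completed, `l` letters of which have
already been read, and runs of lengths `2 * i` for `i` in `L` follow, separated by gaps. -/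
def Admissible (m l k : ℕ) : Prop :=
  ∃ j, IsMersenne j ∧ ∃ L : List ℕ, (∀ i ∈ L, IsMersenne i) ∧
    l ≤ 2 * j ∧ j + L.sum = k ∧ 2 * k + L.length ≤ m + l

theorem Admissible.of_coeff_pathGen_ne_zero {A : Type*} [CommRing A] {y : ℕ → A} {m : ℕ}
    (hy : IsLSSeq y m) {l k : ℕ} (h : (pathGen y m l).coeff k ≠ 0) : Admissible m l k := by
  classical
  induction m generalizing l k with
  | zero =>
    rw [pathGen_zero_left hy.zero] at h
    obtain ⟨p, rfl | rfl⟩ := Nat.even_or_odd' l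
    · rw [ballotPoly_X_zero hy.two_eq_zero] at h
      split_ifs at h with hp
      · rw [Polynomial.coeff_X_pow] at h
        split_ifs at h with hk
        · exact ⟨p, hp, [], by simp, le_rfl, by simp [hk], by simp [hk]⟩
        · simp at h
      · simp at h
    · simp [ballotPoly_two_mul_add_one_zero] at h
  | succ m ih =>
    have hy' : IsLSSeq y m := ⟨hy.two_eq_zero, hy.zero, fun i hi => hy.sq i (by omega)⟩
    rw [pathGen_succ hy.two_eq_zero (hy.sq m (by omega)), Polynomial.coeff_add,
      Polynomial.coeff_C_mul] at h
    by_cases h1 : (pathGen y m (l + 1)).coeff k = 0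
    · rw [h1, mul_zero, zero_add] at h
      obtain ⟨p, rfl | rfl⟩ := Nat.even_or_odd' l
      · rw [ballotPoly_X_zero hy.two_eq_zero] at h
        split_ifs at h with hp
        · rw [Polynomial.coeff_X_pow_mul'] at h
          split_ifs at h with hk
          · obtain ⟨j, hj, L, hL, -, hs, hm⟩ := ih hy' h
            refine ⟨p, hp, j :: L, by simpa using ⟨hj, hL⟩, le_rfl, ?_, ?_⟩
            · rw [List.sum_cons]; omega
            · rw [List.length_cons]; omega
          · exact absurd rfl h
        · simp at h
      · simp [ballotPoly_two_mul_add_one_zero] at h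
    · obtain ⟨j, hj, L, hL, hl, hs, hm⟩ := ih hy' h1
      exact ⟨j, hj, L, hL, by omega, hs, by omega⟩

/-- Adjoining one more variable `ω` with `ω ^ 2 = ω * y m`. -/
theorem IsLSSeq.exists_extend {A : Type} [CommRing A] {y : ℕ → A} {m : ℕ} (hy : IsLSSeq y m) :
    ∃ (D : Type) (_ : CommRing D) (z : ℕ → D), IsLSSeq z (m + 1) ∧ ∀ l k : ℕ,
      (pathGen y m (l + 1)).coeff k ≠ 0 ∨
        (ballotPoly l Polynomial.X 0 * pathGen y m 0).coeff k ≠ 0 →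
      (pathGen z (m + 1) l).coeff k ≠ 0 := by
  let D := QuadraticAlgebra A 0 (y m)
  let f : A →+* D := algebraMap A D
  let z : ℕ → D := fun i => if i ≤ m then f (y i) else QuadraticAlgebra.omega
  have hz : ∀ i ≤ m, z i = f (y i) := fun i hi => if_pos hi
  have hz' : z (m + 1) = QuadraticAlgebra.omega := if_neg (by omega)
  have h2 : (2 : D) = 0 := by rw [← map_ofNat f 2, hy.two_eq_zero, map_zero]
  have hsq : z (m + 1) ^ 2 = z (m + 1) * z m := by
    rw [hz', hz m le_rfl, pow_two, QuadraticAlgebra.omega_mul_omega_eq_algebraMap, map_zero, zero_add,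
      mul_comm]
  refine ⟨D, inferInstance, z, ⟨h2, by rw [hz 0 (by omega), hy.zero, map_zero], ?_⟩, ?_⟩
  · intro i hi
    rcases Nat.lt_succ_iff_lt_or_eq.1 hi with hi | rfl
    · rw [hz _ hi, hz _ hi.le, ← map_pow, hy.sq i hi, map_mul]
    · exact hsq
  · intro l k h h0
    have hB : ballotPoly l (Polynomial.X : Polynomial D) 0
        = (ballotPoly l (Polynomial.X : Polynomial A) 0).map f := by
      rw [← Polynomial.coe_mapRingHom, map_ballotPoly]
      simp
    rw [pathGen_succ h2 hsq, pathGen_map f hz, pathGen_map f hz, hB, ← Polynomial.map_mul,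
      Polynomial.coeff_add, Polynomial.coeff_C_mul, Polynomial.coeff_map, Polynomial.coeff_map,
      hz'] at h0
    have hre := congrArg QuadraticAlgebra.re h0
    have him := congrArg QuadraticAlgebra.im h0
    simp [f, D] at hre him
    tauto

theorem Admissible.exists_coeff_pathGen_ne_zero {m l k : ℕ} (h : Admissible m l k) :
    ∃ (A : Type) (_ : CommRing A) (y : ℕ → A), IsLSSeq y m ∧ (pathGen y m l).coeff k ≠ 0 := by
  classical
  induction m generalizing l k with
  | zero =>
    obtain ⟨j, hj, L, -, hl, hs, hm⟩ := h
    obtain rfl : l = 2 * j := by omega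
    obtain rfl : k = j := by omega
    refine ⟨ZMod 2, inferInstance, 0, ⟨rfl, rfl, by simp⟩, ?_⟩
    rw [pathGen_zero_left rfl, ballotPoly_X_zero rfl, if_pos hj]
    simp
  | succ m ih =>
    obtain ⟨j, hj, L, hL, hl, hs, hm⟩ := h
    rcases hl.lt_or_eq with hl | rfl
    · obtain ⟨A, _, y, hy, hne⟩ := ih (l := l + 1) (k := k) ⟨j, hj, L, hL, hl, hs, by omega⟩
      obtain ⟨D, _, z, hz, hzne⟩ := hy.exists_extend
      exact ⟨D, _, z, hz, hzne l k (Or.inl hne)⟩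
    · have hadm : Admissible m 0 (k - j) := by
        rcases L with _ | ⟨i, L⟩
        · exact ⟨0, ⟨0, rfl⟩, [], by simp, by simp, by simp_all, by simp_all⟩
        · rw [List.sum_cons] at hs
          rw [List.length_cons] at hm
          exact ⟨i, hL i (by simp), L, fun a ha => hL a (by simp [ha]), by omega, by omega,
            by omega⟩
      obtain ⟨A, _, y, hy, hne⟩ := ih hadm
      obtain ⟨D, _, z, hz, hzne⟩ := hy.exists_extend
      refine ⟨D, _, z, hz, hzne _ k (Or.inr ?_)⟩
      rwa [ballotPoly_X_zero hy.two_eq_zero, if_pos hj, Polynomial.coeff_X_pow_mul',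
        if_pos (by omega)]

theorem coeff_sqGen {m : ℕ} {A : Type*} [CommRing A] (φ : MvPolynomial (Fin m) (ZMod 2) →+* A)
    {y : ℕ → A} (hφ : ∀ i : Fin m, φ (X i) = y (m - i)) (k : ℕ) :
    (sqGen y m).coeff k = φ (esymm (Fin m) (ZMod 2) k ^ 2) := by
  have h : sqGen y m = ∏ i : Fin m, (1 + Polynomial.X * Polynomial.C (φ (X i)) ^ 2) := by
    rw [sqGen, ← Finset.prod_range_reflect, Finset.prod_range]
    refine Finset.prod_congr rfl fun i _ => ?_
    rw [hφ, show m - 1 - (i : ℕ) + 1 = m - i by omega]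
  rw [h, Finset.prod_one_add, Polynomial.finsetSum_coeff, esymm, CharTwo.sum_sq, map_sum,
    Finset.powersetCard_eq_filter, Finset.sum_filter]
  refine Finset.sum_congr rfl fun t _ => ?_
  rw [Finset.prod_mul_distrib, Finset.prod_const, Finset.prod_pow, ← map_prod, ← map_pow,
    mul_comm, Polynomial.coeff_C_mul_X_pow, map_pow, map_prod]
  simp only [eq_comm]

theorem isLSSeq_quotient (m : ℕ) :
    IsLSSeq (fun i => if h : 0 < i ∧ i ≤ m then
      Ideal.Quotient.mk (lsIdeal m) (X ⟨m - i, by omega⟩) else 0) m where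
  two_eq_zero := by
    rw [← map_ofNat (Ideal.Quotient.mk (lsIdeal m)) 2,
      CharTwo.two_eq_zero (R := MvPolynomial (Fin m) (ZMod 2)), map_zero]
  zero := by simp
  sq i hi := by
    rw [dif_pos ⟨i.succ_pos, hi⟩, ← map_pow]
    rcases Nat.eq_zero_or_pos i with rfl | hi0
    · rw [dif_neg (by simp), mul_zero, Ideal.Quotient.eq_zero_iff_mem]
      exact Ideal.subset_span (Or.inr ⟨_, rfl, rfl⟩)
    · rw [dif_pos ⟨hi0, hi.le⟩, ← map_mul, Ideal.Quotient.mk_eq_mk_iff_sub_mem, CharTwo.sub_eq_add]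
      exact Ideal.subset_span (Or.inl ⟨_, _, by simp; omega, rfl⟩)

theorem mk_esymm_sq_ne_zero_iff (m k : ℕ) :
    Ideal.Quotient.mk (lsIdeal m) (esymm (Fin m) (ZMod 2) k ^ 2) ≠ 0 ↔ Admissible m 0 k := by
  constructor
  · intro h
    refine Admissible.of_coeff_pathGen_ne_zero (isLSSeq_quotient m) ?_
    rw [pathGen_zero_right, coeff_sqGen (Ideal.Quotient.mk (lsIdeal m))]
    · exact h
    · intro i
      rw [dif_pos (by omega)]
      congr 2
      ext
      simp only
      omega
  · intro h
    obtain ⟨A, _, y, hy, hne⟩ := h.exists_coeff_pathGen_ne_zero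
    have : CharP A 2 := by
      have : Nontrivial A := nontrivial_of_ne _ _ hne
      exact CharTwo.of_one_ne_zero_of_two_eq_zero one_ne_zero hy.two_eq_zero
    let φ : MvPolynomial (Fin m) (ZMod 2) →+* A :=
      eval₂Hom (ZMod.castHom dvd_rfl A) fun i => y (m - i)
    have hφ : ∀ i : Fin m, φ (X i) = y (m - i) := fun i => eval₂Hom_X' _ _ i
    rw [pathGen_zero_right, coeff_sqGen φ hφ] at hne
    refine fun h0 => hne ?_
    have hker : lsIdeal m ≤ RingHom.ker φ := by
      rw [lsIdeal, Ideal.span_le]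
      rintro q (⟨i, j, hij, rfl⟩ | ⟨i, hi, rfl⟩)
      · rw [SetLike.mem_coe, RingHom.mem_ker, map_add, map_pow, map_mul, hφ, hφ]
        have := hy.sq (m - j) (by omega)
        rw [show m - (j : ℕ) + 1 = m - i by omega] at this
        rw [this, CharTwo.add_self_eq_zero]
      · rw [SetLike.mem_coe, RingHom.mem_ker, map_pow, hφ, show m - (i : ℕ) = 0 + 1 by omega,
          hy.sq 0 (by omega), hy.zero, mul_zero]
    exact hker (Ideal.Quotient.eq_zero_iff_mem.1 h0)

theorem admissible_iff_sOf {m k : ℕ} (hk : 1 ≤ k) : Admissible m 0 k ↔ 2 * k + sOf k ≤ m + 1 := by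
  constructor
  · rintro ⟨j, hj, L, hL, -, hs, hm⟩
    have : sOf k ≤ (j :: L).length := by
      refine Nat.sInf_le ⟨by simp, ?_⟩
      have hmem : ∀ i : Fin (j :: L).length, IsMersenne ((j :: L).get i) := fun i => by
        rcases List.mem_cons.1 ((j :: L).get_mem i) with h | h
        · rwa [h]
        · exact hL _ h
      choose r hr using hmem
      refine ⟨r, ?_⟩
      simp only [← hr]
      rw [← List.sum_ofFn, List.ofFn_get, List.sum_cons, hs]
    rw [List.length_cons] at this
    omega
  · intro h
    have hne : {s : ℕ | 1 ≤ s ∧ ∃ r : Fin s → ℕ, k = ∑ j : Fin s, (2 ^ r j - 1)}.Nonempty :=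
      ⟨k, hk, fun _ => 1, by simp⟩
    have hmem : 1 ≤ sOf k ∧ ∃ r : Fin (sOf k) → ℕ, k = ∑ j : Fin (sOf k), (2 ^ r j - 1) :=
      Nat.sInf_mem hne
    generalize sOf k = s at h hmem
    obtain ⟨hs1, r, hr⟩ := hmem
    obtain ⟨s, rfl⟩ := Nat.exists_eq_add_of_le' hs1
    refine ⟨2 ^ r 0 - 1, ⟨_, rfl⟩, List.ofFn fun i : Fin s => 2 ^ r i.succ - 1, ?_, by omega, ?_, ?_⟩
    · intro i hi
      obtain ⟨a, rfl⟩ := (List.mem_ofFn' _ _).1 hi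
      exact ⟨_, rfl⟩
    · rw [List.sum_ofFn, hr, Fin.sum_univ_succ]
    · rw [List.length_ofFn]
      omega

/-- For `n ≥ 2` and `1 ≤ k ≤ n`, the image of `σ_k(x₁,…,x_{n−1})²` in
`F₂[x₁,…,x_{n−1}]/I(n)` is nonzero if and only if `n ≥ 2k + s(k)`. -/
theorem stmt9 (n k : ℕ) (hn : 2 ≤ n) (hk1 : 1 ≤ k) (hk2 : k ≤ n) :
    Ideal.Quotient.mk (lsIdeal (n - 1)) (esymm (Fin (n - 1)) (ZMod 2) k ^ 2) ≠ 0 ↔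
      2 * k + sOf k ≤ n := by
  rw [mk_esymm_sq_ne_zero_iff, admissible_iff_sOf hk1, Nat.sub_add_cancel (by omega)]
end

section
/- For all n ≥ 2 and 1 ≤ k ≤ n, in the quotient ring F₂[x₁,…,x_{n−1}]/I(n) one has σ_k² = Σ_{I ∈ 𝓘_k^max(n−1)} (λ_I mod 2)·x_I², where the right-hand side is taken to be zero if 𝓘_k^max(n−1) is empty. -/
open MvPolynomial

/-- `x_I`: the squarefree monomial associated to a tuple `I` (given as a map
`Fin k → Fin m` of variable indices). -/
noncomputable def xMon {m k : ℕ} (I : Fin k → Fin m) : MvPolynomial (Fin m) (ZMod 2) :=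
  ∏ j : Fin k, X (I j)

/-- The lexicographic order on `k`-tuples: `J ⪯ I` iff `J = I` or `J r < I r` at the
first index `r` where they differ. -/
def lexLe {m k : ℕ} (J I : Fin k → Fin m) : Prop :=
  J = I ∨ ∃ r : Fin k, (∀ s : Fin k, s < r → J s = I s) ∧ J r < I r

/-- The set `𝓘_k^max(m)`: strictly increasing `k`-tuples `I` with entries among the `m`
variables such that `x_I² ≠ 0` in the quotient and `J ⪯ I` for every strictly increasing
`k`-tuple `J` with `x_J² = x_I²` in the quotient. -/
noncomputable def Imax (m k : ℕ) : Set (Fin k → Fin m) :=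
  {I | StrictMono I ∧
    Ideal.Quotient.mk (lsIdeal m) (xMon I ^ 2) ≠ 0 ∧
    ∀ J : Fin k → Fin m, StrictMono J →
      Ideal.Quotient.mk (lsIdeal m) (xMon J ^ 2) =
        Ideal.Quotient.mk (lsIdeal m) (xMon I ^ 2) →
      lexLe J I}

/-- Auxiliary computation of the lengths of the blocks of the canonical decomposition of
a tuple of entries: a new block starts whenever the difference of consecutive entries is
at least `3`.  `prev` is the previous entry and `len` the length of the current block. -/
def blockLengthsAux : ℕ → ℕ → List ℕ → List ℕ
  | _, len, [] => [len]
  | prev, len, b :: rest =>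
    if prev + 3 ≤ b then len :: blockLengthsAux b 1 rest
    else blockLengthsAux b (len + 1) rest

/-- The block lengths `m₁,…,m_s` of the canonical decomposition of a tuple, given as the
list of its entries. -/
def blockLengths : List ℕ → List ℕ
  | [] => []
  | a :: rest => blockLengthsAux a 1 rest

/-- `λ_I = C_{m₁} ⋯ C_{m_s}`, the product of Catalan numbers of the block lengths of the
canonical decomposition of the tuple `I`. -/
def lambdaI {m k : ℕ} (I : Fin k → Fin m) : ℕ :=
  ((blockLengths ((List.ofFn I).map Fin.val)).map catalan).prod

/-- The number of ways to continue, by `r` further entries, a strictly increasing sequence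
which lags by `d` behind a sequence with constant difference `2` and must never overtake it. -/
def ballotCount : ℕ → ℕ → ℕ
  | 0, _ => 1
  | r + 1, d => ∑ e ∈ Finset.range (d + 2), ballotCount r e

theorem ballotCount_succ_succ (r d : ℕ) :
    ballotCount (r + 1) (d + 1) = ballotCount (r + 1) d + ballotCount r (d + 2) := by
  simp only [ballotCount]
  rw [Finset.sum_range_succ]

theorem ballotCount_add_choose (r d : ℕ) :
    ballotCount (r + 1) d + (2 * r + d + 3).choose r = (2 * r + d + 3).choose (r + 1) := by
  induction r generalizing d with
  | zero => simp [ballotCount]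
  | succ s ih =>
    induction d with
    | zero =>
      have h : ballotCount (s + 2) 0 = ballotCount (s + 1) 0 + ballotCount (s + 1) 1 := by
        simp [ballotCount, Finset.sum_range_succ]
      have h0 := ih 0
      have h1 := ih 1
      have hsymm : (2 * s + 3).choose (s + 2) = (2 * s + 3).choose (s + 1) :=
        Nat.choose_symm_of_eq_add (by omega)
      have e1 := Nat.choose_succ_succ (2 * s + 4) s
      have e2 := Nat.choose_succ_succ (2 * s + 4) (s + 1)
      have e3 := Nat.choose_succ_succ (2 * s + 3) s
      have e4 := Nat.choose_succ_succ (2 * s + 3) (s + 1)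
      simp only [Nat.succ_eq_add_one, add_assoc, Nat.reduceAdd, add_zero, mul_add, mul_one] at *
      omega
    | succ d ihd =>
      have h := ballotCount_succ_succ (s + 1) d
      have h2 := ih (d + 2)
      have e1 := Nat.choose_succ_succ (2 * s + d + 5) s
      have e2 := Nat.choose_succ_succ (2 * s + d + 5) (s + 1)
      rw [show 2 * (s + 1) + d + 3 = 2 * s + d + 5 by ring] at ihd
      rw [show 2 * s + (d + 2) + 3 = 2 * s + d + 5 by ring] at h2
      rw [show 2 * (s + 1) + (d + 1) + 3 = 2 * s + d + 5 + 1 by ring]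
      simp only [Nat.succ_eq_add_one, add_assoc, Nat.reduceAdd] at *
      omega

theorem ballotCount_zero_right (r : ℕ) : ballotCount r 0 = catalan (r + 1) := by
  cases r with
  | zero => simp [ballotCount]
  | succ r =>
    have h := ballotCount_add_choose r 0
    have hc := succ_mul_catalan_eq_centralBinom (r + 2)
    have hm := Nat.choose_succ_right_eq (2 * r + 3) r
    have hsymm : (2 * r + 3).choose (r + 2) = (2 * r + 3).choose (r + 1) :=
      Nat.choose_symm_of_eq_add (by omega)
    have hp := Nat.choose_succ_succ (2 * r + 3) (r + 1)
    rw [Nat.centralBinom_eq_two_mul_choose, show 2 * (r + 2) = 2 * r + 3 + 1 by ring] at hc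
    rw [show 2 * r + 3 - r = r + 3 by omega] at hm
    simp only [Nat.succ_eq_add_one, add_assoc, Nat.reduceAdd, add_zero] at *
    refine Nat.eq_of_mul_eq_mul_left (show 0 < r + 3 by omega) ?_
    nlinarith

/-- Push each entry of a list up by as little as needed for the differences of consecutive entries
to be at least `2`, the entry before the list being `q`. -/
def spreadFrom : ℕ → List ℕ → List ℕ
  | _, [] => []
  | q, a :: J => max a (q + 2) :: spreadFrom (max a (q + 2)) J

/-- Push each entry of a list up by as little as needed for the differences of consecutive entries
to be at least `2`. -/
def spread : List ℕ → List ℕ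
  | [] => []
  | a :: J => a :: spreadFrom a J

theorem length_spread (J : List ℕ) : (spread J).length = J.length := by
  have h : ∀ (J : List ℕ) q, (spreadFrom q J).length = J.length := by
    intro J
    induction J with
    | nil => simp [spreadFrom]
    | cons a J ih => simp [spreadFrom, ih]
  cases J <;> simp [spread, h]

theorem pairwise_cons_spreadFrom (q : ℕ) (J : List ℕ) :
    (q :: spreadFrom q J).Pairwise (fun a b => a + 2 ≤ b) := by
  induction J generalizing q with
  | nil => simp [spreadFrom]
  | cons a J ih =>
    have h := ih (max a (q + 2))
    rw [spreadFrom, List.pairwise_cons]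
    refine ⟨fun b hb => ?_, h⟩
    rw [List.pairwise_cons] at h
    rcases List.mem_cons.1 hb with rfl | hb
    · exact le_max_right _ _
    · have := h.1 b hb
      omega

theorem pairwise_spread (J : List ℕ) : (spread J).Pairwise (fun a b => a + 2 ≤ b) := by
  cases J with
  | nil => simp [spread]
  | cons a J => exact pairwise_cons_spreadFrom a J

theorem spread_eq_self {G : List ℕ} (hG : G.Pairwise (fun a b => a + 2 ≤ b)) : spread G = G := by
  have h : ∀ (G : List ℕ) q, (q :: G).Pairwise (fun a b => a + 2 ≤ b) → spreadFrom q G = G := by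
    intro G
    induction G with
    | nil => simp [spreadFrom]
    | cons a G ih =>
      intro q hq
      rw [List.pairwise_cons] at hq
      have ha : max a (q + 2) = a := max_eq_left (hq.1 a (by simp))
      rw [spreadFrom, ha, ih a hq.2]
  cases G with
  | nil => rfl
  | cons a G => rw [spread, h G a hG]

theorem forall₂_le_spread (J : List ℕ) : List.Forall₂ (· ≤ ·) J (spread J) := by
  have h : ∀ (J : List ℕ) q, List.Forall₂ (· ≤ ·) J (spreadFrom q J) := by
    intro J
    induction J with
    | nil => simp [spreadFrom]
    | cons a J ih => exact fun q => .cons (le_max_left _ _) (ih _)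
  cases J with
  | nil => exact .nil
  | cons a J => exact .cons le_rfl (h J a)

/-- The strictly increasing lists with entries larger than `p` which `spreadFrom q` sends
to a given list. -/
def spreadFromFiber : ℕ → ℕ → List ℕ → Finset (List ℕ)
  | _, _, [] => {[]}
  | p, q, b :: I => ((Finset.Ioc p b).filter fun a => max a (q + 2) = b).biUnion fun a =>
      (spreadFromFiber a b I).image (a :: ·)

theorem mem_spreadFromFiber {p q : ℕ} {I J : List ℕ} :
    J ∈ spreadFromFiber p q I ↔ (p :: J).IsChain (· < ·) ∧ spreadFrom q J = I := by
  induction I generalizing p q J with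
  | nil => cases J <;> simp [spreadFromFiber, spreadFrom]
  | cons b I ih =>
    cases J with
    | nil => simp [spreadFromFiber, spreadFrom]
    | cons a J =>
      simp only [spreadFromFiber, Finset.mem_biUnion, Finset.mem_filter, Finset.mem_Ioc,
        Finset.mem_image, ih, spreadFrom, List.cons.injEq, List.isChain_cons_cons]
      constructor
      · rintro ⟨a', ⟨⟨h1, h2⟩, h3⟩, J', ⟨h4, h5⟩, rfl, rfl⟩
        subst h3
        exact ⟨⟨h1, h4⟩, rfl, h5⟩
      · rintro ⟨⟨h1, h4⟩, rfl, h5⟩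
        exact ⟨a, ⟨⟨h1, le_max_left _ _⟩, rfl⟩, J, ⟨h4, h5⟩, rfl, rfl⟩

theorem card_spreadFromFiber_cons (p q b : ℕ) (I : List ℕ) :
    (spreadFromFiber p q (b :: I)).card =
      ∑ a ∈ (Finset.Ioc p b).filter (fun a => max a (q + 2) = b), (spreadFromFiber a b I).card := by
  rw [spreadFromFiber, Finset.card_biUnion]
  · exact Finset.sum_congr rfl fun a _ =>
      Finset.card_image_of_injective _ (List.cons_injective)
  · intro a _ a' _ hne
    simp only [Finset.disjoint_left, Finset.mem_image]
    rintro _ ⟨J, _, rfl⟩ ⟨J', _, h⟩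
    exact hne (List.cons.inj h).1.symm

/-- Both the Catalan product over the blocks and the sizes of the fibres factor through the
length `r` of the remainder of the first block. -/
theorem exists_blockLengthsAux_factor (q : ℕ) (I : List ℕ)
    (hI : (q :: I).IsChain (fun a b => a + 2 ≤ b)) :
    ∃ r c : ℕ,
      (∀ len, ((blockLengthsAux q len I).map catalan).prod = catalan (len + r) * c) ∧
      ∀ d ≤ q, (spreadFromFiber (q - d) q I).card = ballotCount r d * c := by
  induction I generalizing q with
  | nil => exact ⟨0, 1, by simp [blockLengthsAux], by simp [spreadFromFiber, ballotCount]⟩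
  | cons b I ih =>
    rw [List.isChain_cons_cons] at hI
    obtain ⟨r, c, h1, h2⟩ := ih b hI.2
    by_cases hb : q + 3 ≤ b
    · refine ⟨0, catalan (1 + r) * c, fun len => by simp [blockLengthsAux, hb, h1], fun d hd => ?_⟩
      have hf : (Finset.Ioc (q - d) b).filter (fun a => max a (q + 2) = b) = {b} := by
        ext a
        simp only [Finset.mem_filter, Finset.mem_Ioc, Finset.mem_singleton]
        omega
      have := h2 0 (Nat.zero_le _)
      rw [card_spreadFromFiber_cons, hf, Finset.sum_singleton, ballotCount, one_mul, add_comm 1 r,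
        ← ballotCount_zero_right, ← this, Nat.sub_zero]
    · obtain rfl : b = q + 2 := by omega
      refine ⟨r + 1, c, fun len => by simp [blockLengthsAux, h1, add_comm, add_left_comm],
        fun d hd => ?_⟩
      rw [card_spreadFromFiber_cons, ballotCount, Finset.sum_mul]
      refine Finset.sum_bij' (fun a _ => q + 2 - a) (fun e _ => q + 2 - e) ?_ ?_ ?_ ?_ ?_
      · simp only [Finset.mem_filter, Finset.mem_Ioc, Finset.mem_range]
        omega
      · simp only [Finset.mem_filter, Finset.mem_Ioc, Finset.mem_range]
        omega
      · simp only [Finset.mem_filter, Finset.mem_Ioc]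
        omega
      · simp only [Finset.mem_range]
        omega
      · simp only [Finset.mem_filter, Finset.mem_Ioc]
        intro a ha
        rw [← h2 (q + 2 - a) (by omega), show q + 2 - (q + 2 - a) = a by omega]

/-- The strictly increasing lists which `spread` sends to a given list. -/
def spreadFiber : List ℕ → Finset (List ℕ)
  | [] => {[]}
  | a :: I => (spreadFromFiber a a I).image (a :: ·)

theorem mem_spreadFiber {I J : List ℕ} :
    J ∈ spreadFiber I ↔ J.Pairwise (· < ·) ∧ spread J = I := by
  rw [← List.isChain_iff_pairwise]
  cases I with
  | nil => cases J <;> simp [spreadFiber, spread]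
  | cons b I =>
    cases J with
    | nil => simp [spreadFiber, spread]
    | cons a J =>
      simp only [spreadFiber, Finset.mem_image, mem_spreadFromFiber, spread, List.cons.injEq]
      constructor
      · rintro ⟨J', ⟨h1, h2⟩, rfl, rfl⟩
        exact ⟨h1, rfl, h2⟩
      · rintro ⟨h1, rfl, h2⟩
        exact ⟨J, ⟨h1, h2⟩, rfl, rfl⟩

theorem card_spreadFiber {I : List ℕ} (hI : I.Pairwise (fun a b => a + 2 ≤ b)) :
    (spreadFiber I).card = ((blockLengths I).map catalan).prod := by
  cases I with
  | nil => simp [spreadFiber, blockLengths]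
  | cons a I =>
    obtain ⟨r, c, h1, h2⟩ := exists_blockLengthsAux_factor a I hI.isChain
    have := h2 0 (Nat.zero_le _)
    rw [spreadFiber, Finset.card_image_of_injective _ List.cons_injective, blockLengths, h1,
      add_comm, ← ballotCount_zero_right, ← this, Nat.sub_zero]

section Relations

variable {A : Type*} [CommMonoid A] {y : ℕ → A}

theorem mul_prod_sq_eq_mul_prod_spreadFrom (hy : ∀ i, y i * y i = y i * y (i + 1)) {p q : ℕ}
    {J : List ℕ} {u : A} (hJ : (p :: J).IsChain (· < ·))
    (hu : ∀ a, p < a → a ≤ q + 2 → u * y a = u * y (q + 2)) :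
    u * (J.map fun i => y i ^ 2).prod =
      u * ((spreadFrom q J).map fun b => y b * y (b + 1)).prod := by
  induction J generalizing p q u with
  | nil => simp [spreadFrom]
  | cons a J ih =>
    rw [List.isChain_cons_cons] at hJ
    have hstep : u * y a ^ 2 = u * (y (max a (q + 2)) * y (max a (q + 2) + 1)) := by
      rcases le_total a (q + 2) with h | h
      · rw [max_eq_right h, ← hy, sq, ← mul_assoc, ← mul_assoc, hu a hJ.1 h, mul_right_comm,
          hu a hJ.1 h]
      · rw [max_eq_left h, ← hy, sq]
    have habsorb : ∀ c b, c = b + 1 ∨ c = b + 2 →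
        u * (y b * y (b + 1)) * y c = u * (y b * y (b + 1)) * y (b + 2) := by
      rintro c b (rfl | rfl)
      · rw [mul_assoc, mul_assoc, mul_assoc, mul_assoc, hy]
      · rfl
    simp only [spreadFrom, List.map_cons, List.prod_cons]
    rw [← mul_assoc, hstep, ← mul_assoc u (_ * _)]
    refine ih hJ.2 fun c hc hc' => ?_
    by_cases h : c ≤ max a (q + 2)
    · have hb : max a (q + 2) = q + 2 := by omega
      rw [hb] at h ⊢
      calc u * (y (q + 2) * y (q + 2 + 1)) * y c
          = u * y c * (y (q + 2) * y (q + 2 + 1)) := mul_right_comm _ _ _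
        _ = u * ((y (q + 2) * y (q + 2)) * y (q + 2 + 1)) := by
            rw [hu c (hJ.1.trans hc) h]; simp only [mul_assoc]
        _ = u * (y (q + 2) * (y (q + 2 + 1) * y (q + 2 + 1))) := by
            rw [hy]; simp only [mul_assoc]
        _ = _ := by rw [hy]; simp only [mul_assoc]
    · exact habsorb c _ (by omega)

theorem prod_sq_eq_prod_spread (hy : ∀ i, y i * y i = y i * y (i + 1)) {J : List ℕ}
    (hJ : J.Pairwise (· < ·)) :
    (J.map fun i => y i ^ 2).prod = ((spread J).map fun b => y b * y (b + 1)).prod := by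
  cases J with
  | nil => rfl
  | cons a J =>
    simp only [spread, List.map_cons, List.prod_cons]
    rw [sq, hy]
    refine mul_prod_sq_eq_mul_prod_spreadFrom hy hJ.isChain fun c hc hc' => ?_
    obtain rfl | rfl : c = a + 1 ∨ c = a + 2 := by omega
    · rw [mul_assoc, mul_assoc, hy]
    · rfl

end Relations

/-- A ring satisfying the relations of `lsIdeal m` in which distinct squarefree monomials have
distinct nonzero values, built as a tower of quadratic extensions. -/
theorem exists_separating_algebra (m : ℕ) :
    ∃ (R : Type) (_ : CommRing R) (_ : Algebra (ZMod 2) R) (z : ℕ → R),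
      (∀ i, z i * z i = z i * z (i + 1)) ∧ (∀ i, m ≤ i → z i = 0) ∧
      (∀ s : ℕ → Bool, ∏ i ∈ Finset.range m, (if s i then z i else 1) ≠ 0) ∧
      ∀ s t : ℕ → Bool, ∏ i ∈ Finset.range m, (if s i then z i else 1) =
        ∏ i ∈ Finset.range m, (if t i then z i else 1) → ∀ i < m, s i = t i := by
  induction m with
  | zero => exact ⟨ZMod 2, inferInstance, inferInstance, 0, by simp, by simp, by simp, by simp⟩
  | succ m ih =>
    obtain ⟨R, _, _, z, hz, hz0, hne, hinj⟩ := ih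
    let c : R →+* QuadraticAlgebra R 0 (z 0) := algebraMap R _
    let w : ℕ → QuadraticAlgebra R 0 (z 0) := fun i => Nat.casesOn i ⟨0, 1⟩ fun j => c (z j)
    have hw : ∀ s : ℕ → Bool, ∏ i ∈ Finset.range (m + 1), (if s i then w i else 1) =
        if s 0 then ⟨0, ∏ i ∈ Finset.range m, (if s (i + 1) then z i else 1)⟩
        else ⟨∏ i ∈ Finset.range m, (if s (i + 1) then z i else 1), 0⟩ := by
      intro s
      have hc : ∏ i ∈ Finset.range m, (if s (i + 1) then w (i + 1) else 1) =
          c (∏ i ∈ Finset.range m, (if s (i + 1) then z i else 1)) := by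
        rw [map_prod]
        exact Finset.prod_congr rfl fun i _ => by split_ifs <;> simp [w]
      rw [Finset.prod_range_succ', hc]
      generalize ∏ i ∈ Finset.range m, (if s (i + 1) then z i else 1) = u
      split_ifs
      · ext <;> simp [c, w]
      · rw [mul_one]; rfl
    refine ⟨QuadraticAlgebra R 0 (z 0), inferInstance, inferInstance, w, ?_, ?_, ?_, ?_⟩
    · rintro (_ | i)
      · ext <;> simp [c, w]
      · change c (z i) * c (z i) = c (z i) * c (z (i + 1))
        rw [← map_mul, ← map_mul, hz]
    · rintro (_ | i) hi
      · omega
      · change c (z i) = 0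
        rw [hz0 i (by omega), map_zero]
    · intro s
      rw [hw]
      have := hne fun i => s (i + 1)
      split_ifs <;> simpa [QuadraticAlgebra.ext_iff] using this
    · intro s t h
      rw [hw, hw] at h
      have hs := hne fun i => s (i + 1)
      have ht := hne fun i => t (i + 1)
      have hst := hinj (fun i => s (i + 1)) (fun i => t (i + 1))
      rcases hs0 : s 0 <;> rcases ht0 : t 0 <;>
        simp only [hs0, ht0, if_true, if_false, QuadraticAlgebra.ext_iff, Bool.false_eq_true] at h
      · rintro (_ | i) hi
        · rw [hs0, ht0]
        · exact hst h.1 i (by omega)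
      · exact absurd h.1 hs
      · exact absurd h.2 hs
      · rintro (_ | i) hi
        · rw [hs0, ht0]
        · exact hst h.2 i (by omega)

/-- A list with differences at least `2` is determined by the union of the pairs `{b, b + 1}`
for its entries `b`. -/
theorem eq_of_mem_pairs_iff {G H : List ℕ} (hG : G.Pairwise (fun a b => a + 2 ≤ b))
    (hH : H.Pairwise (fun a b => a + 2 ≤ b))
    (h : ∀ i, (i ∈ G ∨ ∃ b ∈ G, i = b + 1) ↔ (i ∈ H ∨ ∃ b ∈ H, i = b + 1)) : G = H := by
  induction G generalizing H with
  | nil =>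
    cases H with
    | nil => rfl
    | cons b H => simpa using h b
  | cons a G ih =>
    cases H with
    | nil => simpa using h a
    | cons b H =>
      rw [List.pairwise_cons] at hG hH
      obtain rfl : a = b := by
        have h1 := (h a).1 (by simp)
        have h2 := (h b).2 (by simp)
        simp only [List.mem_cons, exists_eq_or_imp] at h1 h2
        rcases h1 with (h1 | h1) | h1 | ⟨c, h1, h1'⟩ <;>
          rcases h2 with (h2 | h2) | h2 | ⟨d, h2, h2'⟩ <;>
          first
          | omega
          | (try have := hG.1 _ h2
             try have := hH.1 _ h1
             omega)
      rw [ih hG.2 hH.2 fun i => ?_]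
      have hi := h i
      simp only [List.mem_cons, exists_eq_or_imp] at hi
      constructor
      · intro h1
        have hlt : a + 2 ≤ i := by
          rcases h1 with h1 | ⟨c, h1, rfl⟩ <;> have := hG.1 _ h1 <;> omega
        rcases hi.1 (by tauto) with (h2 | h2) | h2 | h2
        · omega
        · exact .inl h2
        · omega
        · exact .inr h2
      · intro h1
        have hlt : a + 2 ≤ i := by
          rcases h1 with h1 | ⟨c, h1, rfl⟩ <;> have := hH.1 _ h1 <;> omega
        rcases hi.2 (by tauto) with (h2 | h2) | h2 | h2
        · omega
        · exact .inl h2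
        · omega
        · exact .inr h2

theorem prod_pairs_eq_prod_range {M : Type*} [CommMonoid M] (z : ℕ → M) {m : ℕ} {G : List ℕ}
    (hG : G.Pairwise (fun a b => a + 2 ≤ b)) (hm : ∀ b ∈ G, b + 1 < m) :
    (G.map fun b => z b * z (b + 1)).prod =
      ∏ i ∈ Finset.range m, if decide (i ∈ G ∨ ∃ b ∈ G, i = b + 1) then z i else 1 := by
  induction G with
  | nil => simp
  | cons a G ih =>
    rw [List.pairwise_cons] at hG
    have ha := hm a (by simp)
    have hpair : z a * z (a + 1) =
        ∏ i ∈ Finset.range m, if i ∈ ({a, a + 1} : Finset ℕ) then z i else 1 := by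
      rw [Finset.prod_ite_mem, Finset.inter_eq_right.2, Finset.prod_pair (by omega)]
      intro i
      simp only [Finset.mem_insert, Finset.mem_singleton, Finset.mem_range]
      omega
    rw [List.map_cons, List.prod_cons, ih hG.2 fun b hb => hm b (by simp [hb]), hpair,
      ← Finset.prod_mul_distrib]
    refine Finset.prod_congr rfl fun i _ => ?_
    have hdisj : i ∈ ({a, a + 1} : Finset ℕ) → ¬ (i ∈ G ∨ ∃ b ∈ G, i = b + 1) := by
      simp only [Finset.mem_insert, Finset.mem_singleton]
      rintro hi (h | ⟨b, h, h'⟩) <;> have := hG.1 _ h <;> omega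
    have hiff : (i ∈ a :: G ∨ ∃ b ∈ a :: G, i = b + 1) ↔
        i ∈ ({a, a + 1} : Finset ℕ) ∨ (i ∈ G ∨ ∃ b ∈ G, i = b + 1) := by
      simp only [List.mem_cons, exists_eq_or_imp, Finset.mem_insert, Finset.mem_singleton]
      tauto
    simp only [decide_eq_true_eq, hiff]
    by_cases h1 : i ∈ ({a, a + 1} : Finset ℕ)
    · rw [if_pos h1, if_neg (hdisj h1), if_pos (.inl h1), mul_one]
    · simp only [h1, false_or, if_false, one_mul]

/-- The image of the `i`-th variable in the quotient by `lsIdeal m`, and `0` for `m ≤ i`. -/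
noncomputable def lsVar (m i : ℕ) : MvPolynomial (Fin m) (ZMod 2) ⧸ lsIdeal m :=
  if h : i < m then Ideal.Quotient.mk (lsIdeal m) (X ⟨i, h⟩) else 0

theorem lsVar_mul_self (m i : ℕ) : lsVar m i * lsVar m i = lsVar m i * lsVar m (i + 1) := by
  unfold lsVar
  split_ifs with h1 h2 h2
  · rw [← map_mul, ← map_mul, Ideal.Quotient.eq, CharTwo.sub_eq_add, ← sq]
    exact Ideal.subset_span (.inl ⟨_, _, rfl, rfl⟩)
  · rw [mul_zero, ← map_mul, Ideal.Quotient.eq_zero_iff_mem, ← sq]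
    exact Ideal.subset_span (.inr ⟨_, by simp only; omega, rfl⟩)
  · omega
  · simp

theorem exists_lift_lsVar {m : ℕ} {R : Type*} [CommRing R] [Algebra (ZMod 2) R] {z : ℕ → R}
    (hz : ∀ i, z i * z i = z i * z (i + 1)) (hz0 : ∀ i, m ≤ i → z i = 0) :
    ∃ g : (MvPolynomial (Fin m) (ZMod 2) ⧸ lsIdeal m) →+* R, ∀ i, g (lsVar m i) = z i := by
  have hR : ∀ a : R, a + a = 0 := fun a => by
    rw [← two_smul (ZMod 2) a, show (2 : ZMod 2) = 0 by decide, zero_smul]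
  refine ⟨Ideal.Quotient.lift (lsIdeal m) (aeval fun i : Fin m => z i).toRingHom ?_, fun i => ?_⟩
  · intro p hp
    rw [← RingHom.mem_ker]
    refine Ideal.span_le.2 ?_ hp
    rintro _ (⟨i, j, hij, rfl⟩ | ⟨i, hi, rfl⟩)
    · simp [RingHom.mem_ker, sq, hij, hz, hR]
    · have := i.2
      simp [RingHom.mem_ker, sq, hz, hz0 (i + 1) (by omega)]
  · unfold lsVar
    split_ifs with h
    · simp
    · rw [map_zero, hz0 i (by omega)]

theorem lt_of_prod_lsVar_pairs_ne_zero {m : ℕ} {G : List ℕ}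
    (h : (G.map fun b => lsVar m b * lsVar m (b + 1)).prod ≠ 0) : ∀ b ∈ G, b + 1 < m := by
  intro b hb
  by_contra hlt
  refine h (List.prod_eq_zero (List.mem_map.2 ⟨b, hb, ?_⟩))
  rw [lsVar, lsVar, dif_neg hlt, mul_zero]

theorem eq_of_prod_lsVar_pairs_eq {m : ℕ} {G H : List ℕ}
    (hG : G.Pairwise (fun a b => a + 2 ≤ b)) (hH : H.Pairwise (fun a b => a + 2 ≤ b))
    (hne : (G.map fun b => lsVar m b * lsVar m (b + 1)).prod ≠ 0)
    (h : (G.map fun b => lsVar m b * lsVar m (b + 1)).prod =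
      (H.map fun b => lsVar m b * lsVar m (b + 1)).prod) : G = H := by
  have hGm := lt_of_prod_lsVar_pairs_ne_zero hne
  have hHm := lt_of_prod_lsVar_pairs_ne_zero (h ▸ hne)
  obtain ⟨R, _, _, z, hz, hz0, -, hinj⟩ := exists_separating_algebra m
  obtain ⟨g, hg⟩ := exists_lift_lsVar hz hz0
  have hgh := congrArg g h
  simp only [map_list_prod, List.map_map, Function.comp_def, map_mul, hg] at hgh
  rw [prod_pairs_eq_prod_range z hG hGm, prod_pairs_eq_prod_range z hH hHm] at hgh
  have hst := hinj _ _ hgh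
  refine eq_of_mem_pairs_iff hG hH fun i => ?_
  by_cases hi : i < m
  · exact decide_eq_decide.1 (hst i hi)
  · constructor
    · rintro (h | ⟨b, h, rfl⟩) <;> have := hGm _ h <;> omega
    · rintro (h | ⟨b, h, rfl⟩) <;> have := hHm _ h <;> omega

/-- The list of entries of a tuple. -/
def entries {m k : ℕ} (I : Fin k → Fin m) : List ℕ :=
  (List.ofFn I).map Fin.val

theorem entries_injective {m k : ℕ} :
    Function.Injective (entries : (Fin k → Fin m) → List ℕ) := fun _ _ h =>
  List.ofFn_injective (List.map_injective_iff.2 Fin.val_injective h)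

theorem pairwise_entries_iff {m k : ℕ} {I : Fin k → Fin m} :
    (entries I).Pairwise (· < ·) ↔ StrictMono I := by
  rw [entries, List.pairwise_map, List.pairwise_ofFn]
  rfl

theorem exists_entries_eq {m k : ℕ} {L : List ℕ} (hk : L.length = k) (hm : ∀ b ∈ L, b < m) :
    ∃ I : Fin k → Fin m, entries I = L := by
  subst hk
  refine ⟨fun i => ⟨L.get i, hm _ (L.get_mem i)⟩, ?_⟩
  rw [entries, List.map_ofFn]
  exact List.ofFn_get L

theorem mk_xMon_sq {m k : ℕ} (I : Fin k → Fin m) :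
    Ideal.Quotient.mk (lsIdeal m) (xMon I ^ 2) =
      ((entries I).map fun i => lsVar m i ^ 2).prod := by
  rw [entries, List.map_map, List.map_ofFn, List.prod_ofFn, xMon, ← Finset.prod_pow, map_prod]
  refine Finset.prod_congr rfl fun j _ => ?_
  simp [lsVar]

theorem mk_xMon_sq_eq_prod_spread {m k : ℕ} {I : Fin k → Fin m} (hI : StrictMono I) :
    Ideal.Quotient.mk (lsIdeal m) (xMon I ^ 2) =
      ((spread (entries I)).map fun b => lsVar m b * lsVar m (b + 1)).prod := by
  rw [mk_xMon_sq, prod_sq_eq_prod_spread (lsVar_mul_self m) (pairwise_entries_iff.2 hI)]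

theorem spread_entries_of_mem_Imax {m k : ℕ} {I : Fin k → Fin m} (hI : I ∈ Imax m k) :
    spread (entries I) = entries I := by
  obtain ⟨hmono, hne, hmax⟩ := hI
  have hgap := pairwise_spread (entries I)
  have hlt := lt_of_prod_lsVar_pairs_ne_zero (mk_xMon_sq_eq_prod_spread hmono ▸ hne)
  obtain ⟨J, hJ⟩ := exists_entries_eq (k := k)
    (by rw [length_spread]; simp [entries]) fun b hb => Nat.lt_of_succ_lt (hlt b hb)
  have hJmono : StrictMono J := pairwise_entries_iff.1 <| hJ ▸ hgap.imp fun h => by omega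
  have hle : ∀ r, I r ≤ J r := by
    intro r
    have h := (List.forall₂_iff_get.1 (hJ ▸ forall₂_le_spread (entries I))).2 r
      (by simp [entries]) (by simp [entries])
    simpa [entries] using h
  have heq : Ideal.Quotient.mk (lsIdeal m) (xMon J ^ 2) =
      Ideal.Quotient.mk (lsIdeal m) (xMon I ^ 2) := by
    rw [mk_xMon_sq_eq_prod_spread hJmono, mk_xMon_sq_eq_prod_spread hmono, hJ, spread_eq_self hgap]
  rcases hmax J hJmono heq with rfl | ⟨r, -, hr⟩
  · exact hJ.symm
  · exact absurd hr (hle r).not_gt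

open Classical in
/-- The coefficient `lambdaI I` counts the tuples whose monomial has the same square as `xMon I`. -/
theorem card_filter_mk_xMon_sq_eq {m k : ℕ} {I : Fin k → Fin m} (hI : I ∈ Imax m k) :
    (Finset.univ.filter fun J : Fin k → Fin m => StrictMono J ∧
      Ideal.Quotient.mk (lsIdeal m) (xMon J ^ 2) =
        Ideal.Quotient.mk (lsIdeal m) (xMon I ^ 2)).card = lambdaI I := by
  have hself := spread_entries_of_mem_Imax hI
  have hgap := hself ▸ pairwise_spread (entries I)
  have hne := mk_xMon_sq_eq_prod_spread hI.1 ▸ hI.2.1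
  rw [hself] at hne
  rw [lambdaI, ← entries, ← card_spreadFiber hgap]
  refine Finset.card_bij (fun J _ => entries J) ?_ (fun _ _ _ _ h => entries_injective h) ?_
  · intro J hJ
    obtain ⟨-, hmono, heq⟩ := Finset.mem_filter.1 hJ
    rw [mk_xMon_sq_eq_prod_spread hmono, mk_xMon_sq_eq_prod_spread hI.1, hself] at heq
    exact mem_spreadFiber.2 ⟨pairwise_entries_iff.2 hmono,
      (eq_of_prod_lsVar_pairs_eq hgap (pairwise_spread _) hne heq.symm).symm⟩
  · intro L hL
    obtain ⟨hsort, hL⟩ := mem_spreadFiber.1 hL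
    have hlen : L.length = k := by rw [← length_spread, hL]; simp [entries]
    obtain ⟨J, rfl⟩ := exists_entries_eq (m := m) hlen fun b hb => by
      obtain ⟨i, hi, rfl⟩ := List.getElem_of_mem hb
      have h := forall₂_le_spread L
      rw [hL, List.forall₂_iff_get] at h
      refine lt_of_le_of_lt (h.2 i hi (h.1 ▸ hi)) ?_
      simp [entries]
    have hmono := pairwise_entries_iff.1 hsort
    refine ⟨J, Finset.mem_filter.2 ⟨Finset.mem_univ _, hmono, ?_⟩, rfl⟩
    rw [mk_xMon_sq_eq_prod_spread hmono, mk_xMon_sq_eq_prod_spread hI.1, hL, hself]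

theorem lexLe_iff_toLex_le {m k : ℕ} {J I : Fin k → Fin m} : lexLe J I ↔ toLex J ≤ toLex I := by
  rw [le_iff_eq_or_lt, toLex_inj]
  rfl

open Classical in
theorem esymm_eq_sum_xMon (m k : ℕ) :
    esymm (Fin m) (ZMod 2) k = ∑ J : Fin k → Fin m with StrictMono J, xMon J := by
  rw [esymm]
  refine Finset.sum_bij' (fun t ht => t.orderEmbOfFin (Finset.mem_powersetCard.1 ht).2)
    (fun J _ => Finset.univ.image J) ?_ ?_ ?_ ?_ ?_
  · exact fun t ht => Finset.mem_filter.2 ⟨Finset.mem_univ _, OrderEmbedding.strictMono _⟩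
  · intro J hJ
    refine Finset.mem_powersetCard.2 ⟨Finset.subset_univ _, ?_⟩
    rw [Finset.card_image_of_injective _ (Finset.mem_filter.1 hJ).2.injective, Finset.card_univ,
      Fintype.card_fin]
  · intro t ht
    exact Finset.image_orderEmbOfFin_univ _ _
  · intro J hJ
    exact (Finset.orderEmbOfFin_unique _ (fun i => Finset.mem_image_of_mem _ (Finset.mem_univ i))
      (Finset.mem_filter.1 hJ).2).symm
  · intro t ht
    rw [xMon, ← Finset.prod_coe_sort]
    exact (Equiv.prod_comp (t.orderIsoOfFin (Finset.mem_powersetCard.1 ht).2).toEquiv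
      fun i : t => (X (i : Fin m) : MvPolynomial (Fin m) (ZMod 2))).symm

theorem exists_mem_Imax {m k : ℕ} {J : Fin k → Fin m} (hJ : StrictMono J)
    (hne : Ideal.Quotient.mk (lsIdeal m) (xMon J ^ 2) ≠ 0) :
    ∃ I ∈ Imax m k, Ideal.Quotient.mk (lsIdeal m) (xMon I ^ 2) =
      Ideal.Quotient.mk (lsIdeal m) (xMon J ^ 2) := by
  obtain ⟨I, ⟨hI, hIJ⟩, hmax⟩ := Set.exists_max_image
    {I : Fin k → Fin m | StrictMono I ∧ Ideal.Quotient.mk (lsIdeal m) (xMon I ^ 2) =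
      Ideal.Quotient.mk (lsIdeal m) (xMon J ^ 2)} toLex (Set.toFinite _) ⟨J, hJ, rfl⟩
  exact ⟨I, ⟨hI, hIJ ▸ hne, fun K hK hKI => lexLe_iff_toLex_le.2 (hmax K ⟨hK, hKI.trans hIJ⟩)⟩,
    hIJ⟩

theorem eq_of_mem_Imax {m k : ℕ} {I J : Fin k → Fin m} (hI : I ∈ Imax m k) (hJ : J ∈ Imax m k)
    (h : Ideal.Quotient.mk (lsIdeal m) (xMon I ^ 2) =
      Ideal.Quotient.mk (lsIdeal m) (xMon J ^ 2)) : I = J :=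
  toLex_inj.1 <| le_antisymm (lexLe_iff_toLex_le.1 (hJ.2.2 I hI.1 h))
    (lexLe_iff_toLex_le.1 (hI.2.2 J hJ.1 h.symm))

/-- For `n ≥ 2` and `1 ≤ k ≤ n`, in `F₂[x₁,…,x_{n−1}]/I(n)` one has
`σ_k² = Σ_{I ∈ 𝓘_k^max(n−1)} (λ_I mod 2)·x_I²` (zero if `𝓘_k^max(n−1)` is empty). -/
theorem stmt14 (n k : ℕ) (hn : 2 ≤ n) (hk1 : 1 ≤ k) (hk2 : k ≤ n) :
    Ideal.Quotient.mk (lsIdeal (n - 1)) (esymm (Fin (n - 1)) (ZMod 2) k ^ 2) =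
      ∑ᶠ I ∈ Imax (n - 1) k,
        (lambdaI I : ZMod 2) • Ideal.Quotient.mk (lsIdeal (n - 1)) (xMon I ^ 2) := by
  classical
  generalize n - 1 = m
  rw [finsum_mem_eq_finite_toFinset_sum _ (Set.toFinite (Imax m k)), esymm_eq_sum_xMon,
    sum_pow_char, map_sum, ← Finset.sum_filter_ne_zero]
  choose! rep hrep_mem hrep_eq using fun (J : Fin k → Fin m) => exists_mem_Imax (J := J)
  rw [← Finset.sum_fiberwise_of_maps_to (g := rep) (t := (Set.toFinite (Imax m k)).toFinset)]
  · refine Finset.sum_congr rfl fun I hI => ?_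
    rw [Set.Finite.mem_toFinset] at hI
    rw [← card_filter_mk_xMon_sq_eq hI, Nat.cast_smul_eq_nsmul]
    rw [← Finset.sum_const]
    refine Finset.sum_congr ?_ ?_
    · ext J
      simp only [Finset.mem_filter, Finset.mem_univ, true_and]
      constructor
      · rintro ⟨⟨hJ, hne⟩, rfl⟩
        exact ⟨hJ, (hrep_eq J hJ hne).symm⟩
      · rintro ⟨hJ, hIJ⟩
        have hne := hIJ ▸ hI.2.1
        exact ⟨⟨hJ, hne⟩, eq_of_mem_Imax (hrep_mem J hJ hne) hI ((hrep_eq J hJ hne).trans hIJ)⟩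
    · exact fun J hJ => (Finset.mem_filter.1 hJ).2.2
  · intro J hJ
    simp only [Finset.mem_filter, Finset.mem_univ, true_and] at hJ
    exact (Set.Finite.mem_toFinset _).2 (hrep_mem J hJ.1 hJ.2)
end
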